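/- arXiv:1606.03593 — 4 statements merged into one kernel-verified Lean document; each statement's English description precedes it below -/
import Mathlib

section
/- Let n ≥ 0. A bounded linear map D : 𝒜⋊𝔄 → (𝒜⋊𝔄)^(2n+1) is a derivation if and only if there exist derivations D¹_𝒜 : 𝒜 → 𝒜^(2n+1), D¹_𝔄 : 𝔄 → 𝒜^(2n+1), D²_𝔄 : 𝔄 → 𝔄^(2n+1) and a bounded linear map D²_𝒜 : 𝒜 → 𝔄^(2n+1) such that for all a, b ∈ 𝒜 and β ∈ 𝔄: (i) D((a, β)) = (D¹_𝒜(a) + D¹_𝔄(β), D²_𝒜(a) + D²_𝔄(β)); (ii) D¹_𝒜(β·a) = D¹_𝔄(β)∘a + β▴D¹_𝒜(a) and D¹_𝒜(a·β) = a△D¹_𝔄(β) + D¹_𝒜(a)∙β; (iii) D²_𝒜(β·a) = D¹_𝔄(β)∙a + β△D²_𝒜(a) and D²_𝒜(a·β) = a▴D¹_𝔄(β) + D²_𝒜(a)∘β; (iv) D²_𝒜(ab) = D¹_𝒜(a)∙b + a▴D¹_𝒜(b). -/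
set_option maxSynthPendingDepth 5
set_option synthInstance.maxHeartbeats 1000000
set_option maxHeartbeats 4000000

noncomputable section

open ContinuousLinearMap

/-- `𝒜` is a Banach `𝔄`-bimodule with compatible actions. -/
structure BiAction (A B : Type) [NonUnitalNormedRing A] [NormedSpace ℂ A]
    [IsScalarTower ℂ A A] [SMulCommClass ℂ A A]
    [NonUnitalNormedRing B] [NormedSpace ℂ B] [IsScalarTower ℂ B B] [SMulCommClass ℂ B B] :
    Type where
  l : B →L[ℂ] A →L[ℂ] A
  r : A →L[ℂ] B →L[ℂ] A
  l_mul : ∀ (β γ : B) (a : A), l (β * γ) a = l β (l γ a)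
  r_mul : ∀ (a : A) (β γ : B), r a (β * γ) = r (r a β) γ
  lr_assoc : ∀ (β : B) (a : A) (γ : B), r (l β a) γ = l β (r a γ)
  compat_l : ∀ (β : B) (a b : A), l β (a * b) = l β a * b
  compat_r : ∀ (a b : A) (β : B), r (a * b) β = a * r b β
  compat_m : ∀ (a : A) (β : B) (b : A), a * l β b = r a β * b

/-- The multiplication of the amalgamated duplication `𝒜 ⋊ 𝔄`. -/
def dupMul {A B : Type} [NonUnitalNormedRing A] [NormedSpace ℂ A]
    [IsScalarTower ℂ A A] [SMulCommClass ℂ A A]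
    [NonUnitalNormedRing B] [NormedSpace ℂ B] [IsScalarTower ℂ B B] [SMulCommClass ℂ B B]
    (σ : BiAction A B) (x y : A × B) : A × B :=
  (x.1 * y.1 + σ.r x.1 y.2 + σ.l x.2 y.1, x.2 * y.2)

section Step

variable {X Y Z : Type} [NormedAddCommGroup X] [NormedSpace ℂ X]
  [NormedAddCommGroup Y] [NormedSpace ℂ Y] [NormedAddCommGroup Z] [NormedSpace ℂ Z]

/-- One step of the Arens-type dualization of a bounded bilinear map
`f : X × Y → Z`: `step f : Z' × X → Y'` is given by `⟨step f z' x, y⟩ = ⟨z', f x y⟩`. -/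
def step (f : X →L[ℂ] Y →L[ℂ] Z) :
    (Z →L[ℂ] ℂ) →L[ℂ] X →L[ℂ] (Y →L[ℂ] ℂ) :=
  ((ContinuousLinearMap.compL ℂ X (Y →L[ℂ] Z) (Y →L[ℂ] ℂ)).flip f).comp
    (ContinuousLinearMap.compL ℂ Y Z ℂ)

@[simp] theorem step_apply (f : X →L[ℂ] Y →L[ℂ] Z) (z' : Z →L[ℂ] ℂ) (x : X) (y : Y) :
    step f z' x y = z' (f x y) := rfl

end Step

variable (A B : Type) [NonUnitalNormedRing A] [NormedSpace ℂ A]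
    [IsScalarTower ℂ A A] [SMulCommClass ℂ A A]
    [NonUnitalNormedRing B] [NormedSpace ℂ B] [IsScalarTower ℂ B B] [SMulCommClass ℂ B B]

/-- The package of the natural `𝒜 ⋊ 𝔄`-module operations on `𝒜^(2n) × 𝔄^(2n)`
(an even iterated dual).  Here `X = 𝒜^(2n)` and `Y = 𝔄^(2n)`; the right action of
`(a, β)` on `(x, y)` is `(x ∘ a + x ∙ β + y ∙ a, y ∘ β)` and the left action is
`(a △ x + β ▴ x + a ▴ y, β △ y)`.  The fields record all eight component operations,
obtained from the algebra products, the module actions `l`, `r` and iterated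
dualization. -/
structure EvenPack : Type 1 where
  X : Type
  Y : Type
  [nX : NormedAddCommGroup X] [mX : NormedSpace ℂ X]
  [nY : NormedAddCommGroup Y] [mY : NormedSpace ℂ Y]
  /-- `x ∘ a` -/
  rXA : X →L[ℂ] A →L[ℂ] X
  /-- `x ∙ β` -/
  rXB : X →L[ℂ] B →L[ℂ] X
  /-- `y ∙ a` -/
  rYA : Y →L[ℂ] A →L[ℂ] X
  /-- `y ∘ β` -/
  rYB : Y →L[ℂ] B →L[ℂ] Y
  /-- `a △ x` -/
  lAX : A →L[ℂ] X →L[ℂ] X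
  /-- `β ▴ x` -/
  lBX : B →L[ℂ] X →L[ℂ] X
  /-- `a ▴ y` -/
  lAY : A →L[ℂ] Y →L[ℂ] X
  /-- `β △ y` -/
  lBY : B →L[ℂ] Y →L[ℂ] Y

/-- The package of the natural `𝒜 ⋊ 𝔄`-module operations on `𝒜^(2n+1) × 𝔄^(2n+1)`
(an odd iterated dual).  Here `X = 𝒜^(2n+1)` and `Y = 𝔄^(2n+1)`; the right action of
`(a, β)` on `(x, y)` is `(x ∘ a + x ∙ β, x ∙ a + y ∘ β)` and the left action is
`(a △ x + β ▴ x, a ▴ x + β △ y)`. -/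
structure OddPack : Type 1 where
  X : Type
  Y : Type
  [nX : NormedAddCommGroup X] [mX : NormedSpace ℂ X]
  [nY : NormedAddCommGroup Y] [mY : NormedSpace ℂ Y]
  /-- `x ∘ a` -/
  rXA : X →L[ℂ] A →L[ℂ] X
  /-- `x ∙ β` -/
  rXB : X →L[ℂ] B →L[ℂ] X
  /-- `x ∙ a` -/
  rXAY : X →L[ℂ] A →L[ℂ] Y
  /-- `y ∘ β` -/
  rYB : Y →L[ℂ] B →L[ℂ] Y
  /-- `a △ x` -/
  lAX : A →L[ℂ] X →L[ℂ] X
  /-- `β ▴ x` -/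
  lBX : B →L[ℂ] X →L[ℂ] X
  /-- `a ▴ x` -/
  lAXY : A →L[ℂ] X →L[ℂ] Y
  /-- `β △ y` -/
  lBY : B →L[ℂ] Y →L[ℂ] Y

attribute [instance] EvenPack.nX EvenPack.mX EvenPack.nY EvenPack.mY
attribute [instance] OddPack.nX OddPack.mX OddPack.nY OddPack.mY

variable {A B}

/-- Dualization: the operations on `𝒜^(2n+1) × 𝔄^(2n+1)` obtained by transposing those on
`𝒜^(2n) × 𝔄^(2n)`. -/
def dualE (P : EvenPack A B) : OddPack A B where
  X := P.X →L[ℂ] ℂ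
  Y := P.Y →L[ℂ] ℂ
  rXA := step P.lAX
  rXB := step P.lBX
  rXAY := step P.lAY
  rYB := step P.lBY
  lAX := (step P.rXA.flip).flip
  lBX := (step P.rXB.flip).flip
  lAXY := (step P.rYA.flip).flip
  lBY := (step P.rYB.flip).flip

/-- Dualization: the operations on `𝒜^(2n+2) × 𝔄^(2n+2)` obtained by transposing those on
`𝒜^(2n+1) × 𝔄^(2n+1)`. -/
def dualO (P : OddPack A B) : EvenPack A B where
  X := P.X →L[ℂ] ℂ
  Y := P.Y →L[ℂ] ℂ
  rXA := step P.lAX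
  rXB := step P.lBX
  rYA := step P.lAXY
  rYB := step P.lBY
  lAX := (step P.rXA.flip).flip
  lBX := (step P.rXB.flip).flip
  lAY := (step P.rXAY.flip).flip
  lBY := (step P.rYB.flip).flip

/-- The base package: the bimodule `𝒜 ⋊ 𝔄` over itself (`n = 0`). -/
def basePack (σ : BiAction A B) : EvenPack A B where
  X := A
  Y := B
  rXA := (ContinuousLinearMap.mul ℂ A)
  rXB := σ.r
  rYA := σ.l
  rYB := (ContinuousLinearMap.mul ℂ B)
  lAX := (ContinuousLinearMap.mul ℂ A)
  lBX := σ.l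
  lAY := σ.r
  lBY := (ContinuousLinearMap.mul ℂ B)

/-- The operations on `𝒜^(2n) × 𝔄^(2n)`. -/
def evenPackAt (σ : BiAction A B) : ℕ → EvenPack A B
  | 0 => basePack σ
  | n + 1 => dualO (dualE (evenPackAt σ n))

/-- The operations on `𝒜^(2n+1) × 𝔄^(2n+1)`. -/
def oddPackAt (σ : BiAction A B) (n : ℕ) : OddPack A B :=
  dualE (evenPackAt σ n)


/-- The left action of `𝒜 ⋊ 𝔄` on an odd iterated dual `(𝒜 ⋊ 𝔄)^(2n+1) ≅ 𝒜^(2n+1) × 𝔄^(2n+1)`: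
`(a, β)·(x, y) = (a △ x + β ▴ x, a ▴ x + β △ y)`. -/
def leftActO (P : OddPack A B) (s : A × B) (z : P.X × P.Y) : P.X × P.Y :=
  (P.lAX s.1 z.1 + P.lBX s.2 z.1, P.lAXY s.1 z.1 + P.lBY s.2 z.2)

/-- The right action of `𝒜 ⋊ 𝔄` on an odd iterated dual:
`(x, y)·(a, β) = (x ∘ a + x ∙ β, x ∙ a + y ∘ β)`. -/
def rightActO (P : OddPack A B) (z : P.X × P.Y) (t : A × B) : P.X × P.Y :=
  (P.rXA z.1 t.1 + P.rXB z.1 t.2, P.rXAY z.1 t.1 + P.rYB z.2 t.2)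

variable [CompleteSpace A] [CompleteSpace B]

/-- A bounded linear map `D : 𝒜 ⋊ 𝔄 → (𝒜 ⋊ 𝔄)^(2n+1)` is a derivation
if and only if there are derivations `D¹_𝒜 : 𝒜 → 𝒜^(2n+1)`, `D¹_𝔄 : 𝔄 → 𝒜^(2n+1)`,
`D²_𝔄 : 𝔄 → 𝔄^(2n+1)` and a bounded linear map `D²_𝒜 : 𝒜 → 𝔄^(2n+1)` satisfying (i)–(iv). -/
theorem isDerivation_dup_odd_iff (σ : BiAction A B) (n : ℕ)
    (P : OddPack A B) (hP : P = oddPackAt σ n)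
    (D : (A × B) →L[ℂ] (P.X × P.Y)) :
    (∀ s t : A × B, D (dupMul σ s t) = leftActO P s (D t) + rightActO P (D s) t) ↔
      ∃ (D1A : A →L[ℂ] P.X) (D1B : B →L[ℂ] P.X) (D2B : B →L[ℂ] P.Y) (D2A : A →L[ℂ] P.Y),
        -- `D¹_𝒜` is a derivation
        (∀ a b : A, D1A (a * b) = P.lAX a (D1A b) + P.rXA (D1A a) b) ∧
        -- `D¹_𝔄` is a derivation
        (∀ β γ : B, D1B (β * γ) = P.lBX β (D1B γ) + P.rXB (D1B β) γ) ∧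
        -- `D²_𝔄` is a derivation
        (∀ β γ : B, D2B (β * γ) = P.lBY β (D2B γ) + P.rYB (D2B β) γ) ∧
        -- (i)
        (∀ (a : A) (β : B), D (a, β) = (D1A a + D1B β, D2A a + D2B β)) ∧
        -- (ii)
        (∀ (β : B) (a : A), D1A (σ.l β a) = P.rXA (D1B β) a + P.lBX β (D1A a)) ∧
        (∀ (a : A) (β : B), D1A (σ.r a β) = P.lAX a (D1B β) + P.rXB (D1A a) β) ∧
        -- (iii)
        (∀ (β : B) (a : A), D2A (σ.l β a) = P.rXAY (D1B β) a + P.lBY β (D2A a)) ∧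
        (∀ (a : A) (β : B), D2A (σ.r a β) = P.lAXY a (D1B β) + P.rYB (D2A a) β) ∧
        -- (iv)
        (∀ a b : A, D2A (a * b) = P.rXAY (D1A a) b + P.lAXY a (D1A b)) := by
  constructor
  · intro h
    have hAA (a b : A) := h (a, 0) (b, 0)
    have hBB (β γ : B) := h (0, β) (0, γ)
    have hBA (β : B) (a : A) := h (0, β) (a, 0)
    have hAB (a : A) (β : B) := h (a, 0) (0, β)
    simp only [dupMul, leftActO, rightActO, map_zero, zero_apply, mul_zero,
      zero_mul, add_zero, zero_add, Prod.mk_add_mk, Prod.ext_iff] at hAA hBB hBA hAB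
    refine ⟨(ContinuousLinearMap.fst ℂ P.X P.Y).comp (D.comp (ContinuousLinearMap.inl ℂ A B)),
      (ContinuousLinearMap.fst ℂ P.X P.Y).comp (D.comp (ContinuousLinearMap.inr ℂ A B)),
      (ContinuousLinearMap.snd ℂ P.X P.Y).comp (D.comp (ContinuousLinearMap.inr ℂ A B)),
      (ContinuousLinearMap.snd ℂ P.X P.Y).comp (D.comp (ContinuousLinearMap.inl ℂ A B)),
      fun a b => (hAA a b).1, fun β γ => (hBB β γ).1, fun β γ => (hBB β γ).2, fun a β => ?_,
      fun β a => (hBA β a).1.trans (add_comm _ _), fun a β => (hAB a β).1,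
      fun β a => (hBA β a).2.trans (add_comm _ _), fun a β => (hAB a β).2,
      fun a b => (hAA a b).2.trans (add_comm _ _)⟩
    have hsplit : ((a, β) : A × B) = (a, 0) + (0, β) := by simp
    rw [hsplit, map_add]
    rfl
  · rintro ⟨D1A, D1B, D2B, D2A, hA, hB, hB', hD, hl, hr, hl', hr', hAA⟩ ⟨a, β⟩ ⟨b, γ⟩
    simp only [dupMul, leftActO, rightActO, hD, Prod.mk_add_mk, map_add,
      add_apply, hA, hB, hB', hl, hr, hl', hr', hAA]
    ext1 <;> dsimp only <;> abel

end
end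

section
/- Let n be a positive integer such that the closed linear span of 𝒜△𝒜^(2n) equals 𝒜^(2n), or the closed linear span of 𝒜^(2n)∘𝒜 equals 𝒜^(2n). If 𝒜 and 𝔄 are (2n+1)-weakly amenable, then the amalgamated duplication 𝒜⋊𝔄 is (2n+1)-weakly amenable. -/
set_option maxSynthPendingDepth 5
set_option synthInstance.maxHeartbeats 1000000
set_option maxHeartbeats 4000000

noncomputable section

open ContinuousLinearMap

variable (A B : Type) [NonUnitalNormedRing A] [NormedSpace ℂ A]
    [IsScalarTower ℂ A A] [SMulCommClass ℂ A A]
    [NonUnitalNormedRing B] [NormedSpace ℂ B] [IsScalarTower ℂ B B] [SMulCommClass ℂ B B]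

variable {A B}

variable [CompleteSpace A] [CompleteSpace B]

/-- The left action of `𝒜 ⋊ 𝔄` on an even iterated dual `(𝒜 ⋊ 𝔄)^(2n) ≅ 𝒜^(2n) × 𝔄^(2n)`:
`(a, β)·(x, y) = (a △ x + β ▴ x + a ▴ y, β △ y)`. -/
def leftActE (P : EvenPack A B) (s : A × B) (z : P.X × P.Y) : P.X × P.Y :=
  (P.lAX s.1 z.1 + P.lBX s.2 z.1 + P.lAY s.1 z.2, P.lBY s.2 z.2)

/-- The right action of `𝒜 ⋊ 𝔄` on an even iterated dual:
`(x, y)·(a, β) = (x ∘ a + x ∙ β + y ∙ a, y ∘ β)`. -/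
def rightActE (P : EvenPack A B) (z : P.X × P.Y) (t : A × B) : P.X × P.Y :=
  (P.rXA z.1 t.1 + P.rXB z.1 t.2 + P.rYA z.2 t.1, P.rYB z.2 t.2)

variable (σ : BiAction A B)

/-- Every (bounded) derivation `𝒜 ⋊ 𝔄 → (𝒜 ⋊ 𝔄)^(2n+1)` is inner:
`(2n+1)`-weak amenability of `𝒜 ⋊ 𝔄`. -/
def DupWAOdd (P : OddPack A B) : Prop :=
  ∀ D : (A × B) →L[ℂ] (P.X × P.Y),
    (∀ s t : A × B, D (dupMul σ s t) = leftActO P s (D t) + rightActO P (D s) t) →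
    ∃ z : P.X × P.Y, ∀ s : A × B, D s = leftActO P s z - rightActO P z s

/-- Every (bounded) derivation `𝒜 ⋊ 𝔄 → (𝒜 ⋊ 𝔄)^(2n)` is inner:
`(2n)`-weak amenability of `𝒜 ⋊ 𝔄`. -/
def DupWAEven (P : EvenPack A B) : Prop :=
  ∀ D : (A × B) →L[ℂ] (P.X × P.Y),
    (∀ s t : A × B, D (dupMul σ s t) = leftActE P s (D t) + rightActE P (D s) t) →
    ∃ z : P.X × P.Y, ∀ s : A × B, D s = leftActE P s z - rightActE P z s

/-- Every (bounded) derivation `𝒜 → 𝒜^(2n+1)` is inner: `(2n+1)`-weak amenability of `𝒜`. -/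
def AWAOdd (P : OddPack A B) : Prop :=
  ∀ D : A →L[ℂ] P.X,
    (∀ a b : A, D (a * b) = P.lAX a (D b) + P.rXA (D a) b) →
    ∃ x : P.X, ∀ a : A, D a = P.lAX a x - P.rXA x a

/-- Every (bounded) derivation `𝔄 → 𝔄^(2n+1)` is inner: `(2n+1)`-weak amenability of `𝔄`. -/
def BWAOdd (P : OddPack A B) : Prop :=
  ∀ D : B →L[ℂ] P.Y,
    (∀ β γ : B, D (β * γ) = P.lBY β (D γ) + P.rYB (D β) γ) →
    ∃ y : P.Y, ∀ β : B, D β = P.lBY β y - P.rYB y β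

/-- Every (bounded) derivation `𝒜 → 𝒜^(2n)` is inner: `(2n)`-weak amenability of `𝒜`. -/
def AWAEven (P : EvenPack A B) : Prop :=
  ∀ D : A →L[ℂ] P.X,
    (∀ a b : A, D (a * b) = P.lAX a (D b) + P.rXA (D a) b) →
    ∃ x : P.X, ∀ a : A, D a = P.lAX a x - P.rXA x a

/-- Every (bounded) derivation `𝔄 → 𝔄^(2n)` is inner: `(2n)`-weak amenability of `𝔄`. -/
def BWAEven (P : EvenPack A B) : Prop :=
  ∀ D : B →L[ℂ] P.Y,
    (∀ β γ : B, D (β * γ) = P.lBY β (D γ) + P.rYB (D β) γ) →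
    ∃ y : P.Y, ∀ β : B, D β = P.lBY β y - P.rYB y β

set_option linter.unusedSectionVars false

/-- The module identities making an even package a bimodule over `𝒜 ⋊ 𝔄`. -/
structure IsBimodE (P : EvenPack A B) : Prop where
  left : ∀ s t z, leftActE P (dupMul σ s t) z = leftActE P s (leftActE P t z)
  right : ∀ s t z, rightActE P z (dupMul σ s t) = rightActE P (rightActE P z s) t
  mid : ∀ s t z, rightActE P (leftActE P s z) t = leftActE P s (rightActE P z t)

/-- The module identities making an odd package a bimodule over `𝒜 ⋊ 𝔄`. -/
structure IsBimodO (P : OddPack A B) : Prop where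
  left : ∀ s t z, leftActO P (dupMul σ s t) z = leftActO P s (leftActO P t z)
  right : ∀ s t z, rightActO P z (dupMul σ s t) = rightActO P (rightActO P z s) t
  mid : ∀ s t z, rightActO P (leftActO P s z) t = leftActO P s (rightActO P z t)

theorem prod_dual_ext {X Y : Type} [NormedAddCommGroup X] [NormedSpace ℂ X]
    [NormedAddCommGroup Y] [NormedSpace ℂ Y] {w w' : (X →L[ℂ] ℂ) × (Y →L[ℂ] ℂ)}
    (h : ∀ z : X × Y, w.1 z.1 + w.2 z.2 = w'.1 z.1 + w'.2 z.2) : w = w' := by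
  refine Prod.ext (ContinuousLinearMap.ext fun x => ?_) (ContinuousLinearMap.ext fun y => ?_)
  · simpa using h (x, 0)
  · simpa using h (0, y)

/-- The duality pairing between `dualE P` and `P`. -/
def pairE (P : EvenPack A B) (w : (dualE P).X × (dualE P).Y) (z : P.X × P.Y) : ℂ :=
  let f : P.X →L[ℂ] ℂ := w.1
  let g : P.Y →L[ℂ] ℂ := w.2
  f z.1 + g z.2

theorem pairE_ext {P : EvenPack A B} {w w' : (dualE P).X × (dualE P).Y}
    (h : ∀ z, pairE P w z = pairE P w' z) : w = w' :=
  prod_dual_ext h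

/-- The duality pairing between `dualO P` and `P`. -/
def pairO (P : OddPack A B) (w : (dualO P).X × (dualO P).Y) (z : P.X × P.Y) : ℂ :=
  let f : P.X →L[ℂ] ℂ := w.1
  let g : P.Y →L[ℂ] ℂ := w.2
  f z.1 + g z.2

theorem pairO_ext {P : OddPack A B} {w w' : (dualO P).X × (dualO P).Y}
    (h : ∀ z, pairO P w z = pairO P w' z) : w = w' :=
  prod_dual_ext h

theorem pairE_leftActO (P : EvenPack A B) (s : A × B)
    (w : (dualE P).X × (dualE P).Y) (z : P.X × P.Y) :
    pairE P (leftActO (dualE P) s w) z = pairE P w (rightActE P z s) := by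
  obtain ⟨(f : P.X →L[ℂ] ℂ), (g : P.Y →L[ℂ] ℂ)⟩ := w
  change f (P.rXA z.1 s.1) + f (P.rXB z.1 s.2) +
    (f (P.rYA z.2 s.1) + g (P.rYB z.2 s.2)) =
    f (P.rXA z.1 s.1 + P.rXB z.1 s.2 + P.rYA z.2 s.1) + g (P.rYB z.2 s.2)
  rw [map_add, map_add]
  ring

theorem pairE_rightActO (P : EvenPack A B) (s : A × B)
    (w : (dualE P).X × (dualE P).Y) (z : P.X × P.Y) :
    pairE P (rightActO (dualE P) w s) z = pairE P w (leftActE P s z) := by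
  obtain ⟨(f : P.X →L[ℂ] ℂ), (g : P.Y →L[ℂ] ℂ)⟩ := w
  change f (P.lAX s.1 z.1) + f (P.lBX s.2 z.1) +
    (f (P.lAY s.1 z.2) + g (P.lBY s.2 z.2)) =
    f (P.lAX s.1 z.1 + P.lBX s.2 z.1 + P.lAY s.1 z.2) + g (P.lBY s.2 z.2)
  rw [map_add, map_add]
  ring

theorem pairO_leftActE (P : OddPack A B) (s : A × B)
    (w : (dualO P).X × (dualO P).Y) (z : P.X × P.Y) :
    pairO P (leftActE (dualO P) s w) z = pairO P w (rightActO P z s) := by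
  obtain ⟨(f : P.X →L[ℂ] ℂ), (g : P.Y →L[ℂ] ℂ)⟩ := w
  change f (P.rXA z.1 s.1) + f (P.rXB z.1 s.2) + g (P.rXAY z.1 s.1) +
    g (P.rYB z.2 s.2) =
    f (P.rXA z.1 s.1 + P.rXB z.1 s.2) + g (P.rXAY z.1 s.1 + P.rYB z.2 s.2)
  rw [map_add, map_add]
  ring

theorem pairO_rightActE (P : OddPack A B) (s : A × B)
    (w : (dualO P).X × (dualO P).Y) (z : P.X × P.Y) :
    pairO P (rightActE (dualO P) w s) z = pairO P w (leftActO P s z) := by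
  obtain ⟨(f : P.X →L[ℂ] ℂ), (g : P.Y →L[ℂ] ℂ)⟩ := w
  change f (P.lAX s.1 z.1) + f (P.lBX s.2 z.1) + g (P.lAXY s.1 z.1) +
    g (P.lBY s.2 z.2) =
    f (P.lAX s.1 z.1 + P.lBX s.2 z.1) + g (P.lAXY s.1 z.1 + P.lBY s.2 z.2)
  rw [map_add, map_add]
  ring

variable {σ}

theorem IsBimodE.dualE {P : EvenPack A B} (h : IsBimodE σ P) : IsBimodO σ (dualE P) where
  left s t w := pairE_ext fun z => by
    rw [pairE_leftActO, pairE_leftActO, pairE_leftActO, h.right]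
  right s t w := pairE_ext fun z => by
    rw [pairE_rightActO, pairE_rightActO, pairE_rightActO, h.left]
  mid s t w := pairE_ext fun z => by
    rw [pairE_rightActO, pairE_leftActO, pairE_leftActO, pairE_rightActO, h.mid]

theorem IsBimodO.dualO {P : OddPack A B} (h : IsBimodO σ P) : IsBimodE σ (dualO P) where
  left s t w := pairO_ext fun z => by
    rw [pairO_leftActE, pairO_leftActE, pairO_leftActE, h.right]
  right s t w := pairO_ext fun z => by
    rw [pairO_rightActE, pairO_rightActE, pairO_rightActE, h.left]
  mid s t w := pairO_ext fun z => by
    rw [pairO_rightActE, pairO_leftActE, pairO_leftActE, pairO_rightActE, h.mid]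

variable (σ)

theorem dupMul_assoc (s t u : A × B) :
    dupMul σ (dupMul σ s t) u = dupMul σ s (dupMul σ t u) := by
  refine Prod.ext ?_ (mul_assoc _ _ _)
  simp only [dupMul, map_add, add_apply, add_mul, mul_add, σ.l_mul, σ.r_mul,
    σ.lr_assoc, σ.compat_l, σ.compat_r, σ.compat_m, mul_assoc]
  abel

theorem leftActE_basePack (s t : A × B) : leftActE (basePack σ) s t = dupMul σ s t :=
  Prod.ext (add_right_comm _ _ _) rfl

theorem rightActE_basePack (s t : A × B) : rightActE (basePack σ) s t = dupMul σ s t := rfl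

theorem isBimodE_basePack : IsBimodE σ (basePack σ) where
  left s t z :=
    (leftActE_basePack σ _ _).trans <| (dupMul_assoc σ s t z).trans <|
      (leftActE_basePack σ s _).symm.trans <|
        congrArg (leftActE (basePack σ) s) (leftActE_basePack σ t z).symm
  right s t z := (dupMul_assoc σ z s t).symm
  mid s t z :=
    (congrArg (fun u => dupMul σ u t) (leftActE_basePack σ s z)).trans <|
      (dupMul_assoc σ s z t).trans (leftActE_basePack σ s _).symm

theorem isBimodE_evenPackAt : ∀ n, IsBimodE σ (evenPackAt σ n)
  | 0 => isBimodE_basePack σ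
  | n + 1 => (isBimodE_evenPackAt n).dualE.dualO

/-- A nonzero functional on `𝒜` that kills products extends to a nonzero functional on `𝒜^(2n)`
that kills `𝒜 △ 𝒜^(2n)` and `𝒜^(2n) ∘ 𝒜`. -/
theorem exists_functional_evenPackAt (f : A →L[ℂ] ℂ) (hf : ∀ a b, f (a * b) = 0) (hf0 : f ≠ 0) :
    ∀ n, ∃ F : (evenPackAt σ n).X →L[ℂ] ℂ, F ≠ 0 ∧
      (∀ a x, F ((evenPackAt σ n).lAX a x) = 0) ∧ ∀ x a, F ((evenPackAt σ n).rXA x a) = 0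
  | 0 => ⟨f, hf0, hf, hf⟩
  | n + 1 => by
    obtain ⟨F, hF0, hl, hr⟩ := exists_functional_evenPackAt f hf hf0 n
    refine ⟨ContinuousLinearMap.apply ℂ ℂ F, fun h => hF0 ?_, fun a φ => ?_, fun φ a => ?_⟩
    · ext x
      exact congrArg (fun G => G (ContinuousLinearMap.apply ℂ ℂ x)) h
    · have h0 : (dualE (evenPackAt σ n)).rXA F a = 0 :=
        ContinuousLinearMap.ext fun x => hl a x
      let ψ : ((evenPackAt σ n).X →L[ℂ] ℂ) →L[ℂ] ℂ := φ
      exact (congrArg ψ h0).trans (map_zero ψ)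
    · have h0 : (dualE (evenPackAt σ n)).lAX a F = 0 :=
        ContinuousLinearMap.ext fun x => hr x a
      let ψ : ((evenPackAt σ n).X →L[ℂ] ℂ) →L[ℂ] ℂ := φ
      exact (congrArg ψ h0).trans (map_zero ψ)

theorem eq_zero_of_span_dense {X ι : Type} [NormedAddCommGroup X] [NormedSpace ℂ X] {g : ι → X}
    (hg : (Submodule.span ℂ (Set.range g)).topologicalClosure = ⊤) (F : X →L[ℂ] ℂ)
    (hF : ∀ i, F (g i) = 0) : F = 0 := by
  have hd : Dense (Submodule.span ℂ (Set.range g) : Set X) :=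
    Submodule.dense_iff_topologicalClosure_eq_top.mpr hg
  refine ContinuousLinearMap.ext_on hd ?_
  rintro _ ⟨i, rfl⟩
  exact hF i

variable {σ}

theorem IsBimodO.inner_leibniz {P : OddPack A B} (h : IsBimodO σ P) (z : P.X × P.Y)
    (D : A × B → P.X × P.Y)
    (hD : ∀ s t, D (dupMul σ s t) = leftActO P s (D t) + rightActO P (D s) t) (s t : A × B) :
    D (dupMul σ s t) - (leftActO P (dupMul σ s t) z - rightActO P z (dupMul σ s t)) =
      leftActO P s (D t - (leftActO P t z - rightActO P z t)) +
        rightActO P (D s - (leftActO P s z - rightActO P z s)) t := by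
  have hl : ∀ s u v, leftActO P s (u - v) = leftActO P s u - leftActO P s v := fun s u v => by
    ext <;> simp [leftActO] <;> abel
  have hr : ∀ s u v, rightActO P (u - v) s = rightActO P u s - rightActO P v s := fun s u v => by
    ext <;> simp [rightActO] <;> abel
  rw [hD, hl, hl, hr, hr, h.left, h.right, h.mid]
  abel

theorem dupWAOdd_dualE {E : EvenPack A B} (hbi : IsBimodE σ E)
    (hker : ∀ F : E.X →L[ℂ] ℂ, (∀ x a, F (E.rXA x a) = 0) → (∀ a x, F (E.lAX a x) = 0) → F = 0)
    (hsq : ∀ f : A →L[ℂ] ℂ, (∀ a b, f (a * b) = 0) → f = 0)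
    (hA : AWAOdd (dualE E)) (hB : BWAOdd (dualE E)) : DupWAOdd σ (dualE E) := by
  set P := dualE E
  have hbi' : IsBimodO σ P := hbi.dualE
  intro D hD
  obtain ⟨x, hx⟩ := hA ((ContinuousLinearMap.fst ℂ P.X P.Y).comp
      (D.comp (ContinuousLinearMap.inl ℂ A B))) fun a b => by
    have := congrArg Prod.fst (hD (a, 0) (b, 0))
    simpa [dupMul, leftActO, rightActO] using this
  obtain ⟨y, hy⟩ := hB ((ContinuousLinearMap.snd ℂ P.X P.Y).comp
      (D.comp (ContinuousLinearMap.inr ℂ A B))) fun β γ => by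
    have := congrArg Prod.snd (hD (0, β) (0, γ))
    simpa [dupMul, leftActO, rightActO] using this
  have hL := hbi'.inner_leibniz (x, y) D hD
  set δ : A × B → P.X × P.Y :=
    fun s => D s - (leftActO P s (x, y) - rightActO P (x, y) s) with hδ
  have hL' : ∀ s t, δ (dupMul σ s t) = leftActO P s (δ t) + rightActO P (δ s) t := hL
  have hfst : ∀ a, (δ (a, 0)).1 = 0 := fun a => by
    have := hx a
    simp only [ContinuousLinearMap.comp_apply, ContinuousLinearMap.inl_apply,
      ContinuousLinearMap.coe_fst'] at this
    simp [hδ, leftActO, rightActO, this]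
  have hsnd : ∀ β, (δ (0, β)).2 = 0 := fun β => by
    have := hy β
    simp only [ContinuousLinearMap.comp_apply, ContinuousLinearMap.inr_apply,
      ContinuousLinearMap.coe_snd'] at this
    simp [hδ, leftActO, rightActO, this]
  have hfst' : ∀ β, (δ (0, β)).1 = 0 := fun β => by
    refine hker _ (fun u a => ?_) fun a u => ?_
    · have h1 := congrArg Prod.fst (hL' (a, 0) (0, β))
      have h2 : P.lAX a (δ (0, β)).1 = 0 := by
        simpa [dupMul, leftActO, rightActO, hfst] using h1.symm
      exact congrArg (fun G : E.X →L[ℂ] ℂ => G u) h2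
    · have h1 := congrArg Prod.fst (hL' (0, β) (a, 0))
      have h2 : P.rXA (δ (0, β)).1 a = 0 := by
        simpa [dupMul, leftActO, rightActO, hfst] using h1.symm
      exact congrArg (fun G : E.X →L[ℂ] ℂ => G u) h2
  have hsnd' : ∀ a, (δ (a, 0)).2 = 0 := fun a => by
    refine ContinuousLinearMap.ext fun (v : E.Y) => ?_
    let T : A →L[ℂ] P.Y := (ContinuousLinearMap.snd ℂ P.X P.Y).comp
      (D.comp (ContinuousLinearMap.inl ℂ A B)) - (P.lAXY.flip x - P.rXAY x)
    have hT : ∀ a, T a = (δ (a, 0)).2 := fun a => by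
      simp [T, hδ, leftActO, rightActO]
    let ev : P.Y →L[ℂ] ℂ := ContinuousLinearMap.apply ℂ ℂ v
    have h0 : ev.comp T = 0 := hsq _ fun a b => by
      have h1 := congrArg Prod.snd (hL' (a, 0) (b, 0))
      have h2 : (δ (a * b, 0)).2 = 0 := by
        simpa [dupMul, leftActO, rightActO, hfst] using h1
      rw [ContinuousLinearMap.comp_apply, hT, h2, map_zero]
    have h3 := congrArg (fun G => G a) h0
    simp only [ContinuousLinearMap.comp_apply, hT] at h3
    exact h3
  refine ⟨(x, y), fun s => sub_eq_zero.mp ?_⟩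
  have hadd : δ s = δ (s.1, 0) + δ (0, s.2) := by
    have hs : D s = D (s.1, 0) + D (0, s.2) := by
      rw [← map_add]
      simp
    simp only [hδ, hs]
    ext <;> simp [leftActO, rightActO] <;> abel
  change δ s = 0
  rw [hadd]
  ext
  · simp [hfst, hfst']
  · simp [hsnd, hsnd']

variable (σ)

/-- Let `n ≥ 1` be such that the closed linear span of `𝒜 △ 𝒜^(2n)` is
`𝒜^(2n)` or the closed linear span of `𝒜^(2n) ∘ 𝒜` is `𝒜^(2n)`.  If `𝒜` and `𝔄` are
`(2n+1)`-weakly amenable, then so is `𝒜 ⋊ 𝔄`. -/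
theorem dup_weakly_amenable_odd (n : ℕ) (hn : 0 < n)
    (E : EvenPack A B) (hE : E = evenPackAt σ n)
    (P : OddPack A B) (hP : P = oddPackAt σ n)
    (hspan :
      (Submodule.span ℂ (Set.range fun p : A × E.X => E.lAX p.1 p.2)).topologicalClosure = ⊤ ∨
      (Submodule.span ℂ (Set.range fun p : E.X × A => E.rXA p.1 p.2)).topologicalClosure = ⊤)
    (hA : AWAOdd P) (hB : BWAOdd P) :
    DupWAOdd σ P := by
  subst hE hP
  have hker : ∀ F : (evenPackAt σ n).X →L[ℂ] ℂ, (∀ x a, F ((evenPackAt σ n).rXA x a) = 0) →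
      (∀ a x, F ((evenPackAt σ n).lAX a x) = 0) → F = 0 := fun F hr hl =>
    hspan.elim (fun h => eq_zero_of_span_dense h F fun p => hl p.1 p.2)
      (fun h => eq_zero_of_span_dense h F fun p => hr p.1 p.2)
  refine dupWAOdd_dualE (isBimodE_evenPackAt σ n) hker (fun f hf => ?_) hA hB
  by_contra hf0
  obtain ⟨F, hF0, hl, hr⟩ := exists_functional_evenPackAt σ f hf hf0 n
  exact hF0 (hker F hr hl)

end
end

section
/- Let n ∈ ℕ ∪ {0} and suppose the amalgamated duplication 𝒜⋊𝔄 is (2n+1)-weakly amenable. Then: (i) 𝔄 is (2n+1)-weakly amenable; and (ii) if the pair (𝒜, 𝔄) has property (H_{2n+1}), then 𝒜 is (2n+1)-weakly amenable. -/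
set_option maxSynthPendingDepth 5
set_option synthInstance.maxHeartbeats 1000000
set_option maxHeartbeats 4000000

noncomputable section

open ContinuousLinearMap

variable (A B : Type) [NonUnitalNormedRing A] [NormedSpace ℂ A]
    [IsScalarTower ℂ A A] [SMulCommClass ℂ A A]
    [NonUnitalNormedRing B] [NormedSpace ℂ B] [IsScalarTower ℂ B B] [SMulCommClass ℂ B B]

variable {A B}

variable [CompleteSpace A] [CompleteSpace B]

variable (σ : BiAction A B)

/-- The pair `(𝒜, 𝔄)` has property `(H_{2n+1})`: every derivation `D¹_𝒜 : 𝒜 → 𝒜^(2n+1)`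
admits a derivation `D¹_𝔄 : 𝔄 → 𝒜^(2n+1)` and a bounded linear map `D²_𝒜 : 𝒜 → 𝔄^(2n+1)`
satisfying conditions (ii)–(iv) of the characterization of derivations on `𝒜 ⋊ 𝔄`. -/
def PropertyH (P : OddPack A B) : Prop :=
  ∀ D1A : A →L[ℂ] P.X,
    (∀ a b : A, D1A (a * b) = P.lAX a (D1A b) + P.rXA (D1A a) b) →
    ∃ (D1B : B →L[ℂ] P.X) (D2A : A →L[ℂ] P.Y),
      (∀ β γ : B, D1B (β * γ) = P.lBX β (D1B γ) + P.rXB (D1B β) γ) ∧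
      (∀ (β : B) (a : A), D1A (σ.l β a) = P.rXA (D1B β) a + P.lBX β (D1A a)) ∧
      (∀ (a : A) (β : B), D1A (σ.r a β) = P.lAX a (D1B β) + P.rXB (D1A a) β) ∧
      (∀ (β : B) (a : A), D2A (σ.l β a) = P.rXAY (D1B β) a + P.lBY β (D2A a)) ∧
      (∀ (a : A) (β : B), D2A (σ.r a β) = P.lAXY a (D1B β) + P.rYB (D2A a) β) ∧
      (∀ a b : A, D2A (a * b) = P.rXAY (D1A a) b + P.lAXY a (D1A b))

/-- If `𝒜 ⋊ 𝔄` is `(2n+1)`-weakly amenable then (i) `𝔄` is `(2n+1)`-weakly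
amenable, and (ii) if `(𝒜, 𝔄)` has property `(H_{2n+1})` then `𝒜` is `(2n+1)`-weakly
amenable. -/
theorem dup_weakly_amenable_odd_necc (n : ℕ)
    (P : OddPack A B) (hP : P = oddPackAt σ n)
    (h : DupWAOdd σ P) :
    BWAOdd P ∧ (PropertyH σ P → AWAOdd P) := by
  refine ⟨fun D hD => ?_, fun hH D hD => ?_⟩
  · let E : (A × B) →L[ℂ] (P.X × P.Y) :=
      (ContinuousLinearMap.inr ℂ P.X P.Y).comp (D.comp (ContinuousLinearMap.snd ℂ A B))
    have hE (s : A × B) : E s = (0, D s.2) := rfl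
    obtain ⟨z, hz⟩ := h E fun s t => by
      simp [hE, dupMul, leftActO, rightActO, hD]
    exact ⟨z.2, fun β => by
      simpa [hE, leftActO, rightActO] using congrArg Prod.snd (hz (0, β))⟩
  · obtain ⟨D1B, D2A, hB, hl, hr, hl', hr', hmul⟩ := hH D hD
    let E : (A × B) →L[ℂ] (P.X × P.Y) :=
      (D.coprod D1B).prod (D2A.comp (ContinuousLinearMap.fst ℂ A B))
    have hE (s : A × B) : E s = (D s.1 + D1B s.2, D2A s.1) := rfl
    obtain ⟨z, hz⟩ := h E fun s t => by
      simp only [hE, dupMul, leftActO, rightActO, map_add, add_apply, hD, hB, hl, hr, hl', hr',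
        hmul, Prod.mk_add_mk, Prod.mk.injEq]
      constructor <;> abel
    exact ⟨z.1, fun a => by
      simpa [hE, leftActO, rightActO] using congrArg Prod.fst (hz (a, 0))⟩

end
end

section
/- Let 𝒜 be unital and let n ∈ ℕ ∪ {0}. Then the amalgamated duplication 𝒜⋊𝔄 is n-weakly amenable if and only if both 𝒜 and 𝔄 are n-weakly amenable. -/
set_option maxSynthPendingDepth 5
set_option synthInstance.maxHeartbeats 1000000
set_option maxHeartbeats 4000000

noncomputable section

open ContinuousLinearMap

variable (A B : Type) [NonUnitalNormedRing A] [NormedSpace ℂ A]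
    [IsScalarTower ℂ A A] [SMulCommClass ℂ A A]
    [NonUnitalNormedRing B] [NormedSpace ℂ B] [IsScalarTower ℂ B B] [SMulCommClass ℂ B B]

variable {A B}

variable [CompleteSpace A] [CompleteSpace B]

variable (σ : BiAction A B)

section Derivations

variable {S S' M M' : Type} [NormedAddCommGroup S] [NormedSpace ℂ S]
  [NormedAddCommGroup S'] [NormedSpace ℂ S'] [NormedAddCommGroup M] [NormedSpace ℂ M]
  [NormedAddCommGroup M'] [NormedSpace ℂ M']

/-- Every bounded derivation `S → M`, with respect to a multiplication on `S` and left and right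
actions of `S` on `M`, is inner. -/
def DerivationsInner (mul : S → S → S) (l : S → M → M) (r : M → S → M) : Prop :=
  ∀ D : S →L[ℂ] M, (∀ s t, D (mul s t) = l s (D t) + r (D s) t) →
    ∃ z : M, ∀ s, D s = l s z - r z s

variable {mul : S → S → S} {l : S → M → M} {r : M → S → M}
  {mul' : S' → S' → S'} {l' : S' → M' → M'} {r' : M' → S' → M'}

theorem DerivationsInner.of_equiv (φ : S ≃L[ℂ] S') (Φ : M ≃L[ℂ] M')
    (hmul : ∀ s t, φ (mul s t) = mul' (φ s) (φ t))
    (hl : ∀ s z, Φ (l s z) = l' (φ s) (Φ z)) (hr : ∀ z s, Φ (r z s) = r' (Φ z) (φ s))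
    (h : DerivationsInner mul l r) : DerivationsInner mul' l' r' := by
  intro D hD
  obtain ⟨z, hz⟩ := h ((Φ.symm : M' →L[ℂ] M).comp (D.comp (φ : S →L[ℂ] S'))) fun s t => by
    apply Φ.injective
    simp [hmul, hD, hl, hr]
  refine ⟨Φ z, fun s => ?_⟩
  obtain ⟨s, rfl⟩ := φ.surjective s
  have h := congrArg Φ (hz s)
  simpa [hl, hr] using h

theorem derivationsInner_congr (φ : S ≃L[ℂ] S') (Φ : M ≃L[ℂ] M')
    (hmul : ∀ s t, φ (mul s t) = mul' (φ s) (φ t))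
    (hl : ∀ s z, Φ (l s z) = l' (φ s) (Φ z)) (hr : ∀ z s, Φ (r z s) = r' (Φ z) (φ s)) :
    DerivationsInner mul l r ↔ DerivationsInner mul' l' r' := by
  refine ⟨.of_equiv φ Φ hmul hl hr, .of_equiv φ.symm Φ.symm (fun s t => ?_) (fun s z => ?_)
    fun z s => ?_⟩
  · apply φ.injective; simp [hmul]
  · apply Φ.injective; simp [hl]
  · apply Φ.injective; simp [hr]

end Derivations

section DirectSum

variable {R S X Y : Type} [NonUnitalNormedRing R] [NormedSpace ℂ R]
  [NonUnitalNormedRing S] [NormedSpace ℂ S]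
  [NormedAddCommGroup X] [NormedSpace ℂ X] [NormedAddCommGroup Y] [NormedSpace ℂ Y]

/-- For the direct sum of algebras, with the first one unital, acting componentwise. -/
theorem derivationsInner_prod_iff (lX : R →L[ℂ] X →L[ℂ] X) (rX : X →L[ℂ] R →L[ℂ] X)
    (lY : S →L[ℂ] Y →L[ℂ] Y) (rY : Y →L[ℂ] S →L[ℂ] Y)
    (e : R) (he : ∀ a : R, a * e = a) (hl : ∀ x, lX e x = x) :
    DerivationsInner (S := R × S) (M := X × Y) (fun s t => s * t)
        (fun s z => (lX s.1 z.1, lY s.2 z.2)) (fun z s => (rX z.1 s.1, rY z.2 s.2)) ↔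
      DerivationsInner (fun a b : R => a * b) (fun a x => lX a x) (fun x a => rX x a) ∧
      DerivationsInner (fun a b : S => a * b) (fun a y => lY a y) (fun y a => rY y a) := by
  constructor
  · intro h
    constructor
    · intro D hD
      obtain ⟨z, hz⟩ := h ((inl ℂ X Y).comp (D.comp (fst ℂ R S))) fun s t => by simp [hD]
      exact ⟨z.1, fun a => by simpa using congrArg Prod.fst (hz (a, 0))⟩
    · intro D hD
      obtain ⟨z, hz⟩ := h ((inr ℂ X Y).comp (D.comp (snd ℂ R S))) fun s t => by simp [hD]
      exact ⟨z.2, fun a => by simpa using congrArg Prod.snd (hz (0, a))⟩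
  · rintro ⟨hX, hY⟩ D hD
    obtain ⟨x, hx⟩ := hX ((fst ℂ X Y).comp (D.comp (inl ℂ R S))) fun a b => by
      simpa using congrArg Prod.fst (hD (a, 0) (b, 0))
    obtain ⟨y, hy⟩ := hY ((snd ℂ X Y).comp (D.comp (inr ℂ R S))) fun a b => by
      simpa using congrArg Prod.snd (hD (0, a) (0, b))
    have hRY (a : R) : (D (a, 0)).2 = 0 := by
      simpa [he] using congrArg Prod.snd (hD (a, 0) (e, 0))
    have hSX (b : S) : (D (0, b)).1 = 0 := by
      have h0 : D (0, 0) = 0 := map_zero D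
      simpa [hl, h0] using (congrArg Prod.fst (hD (e, 0) (0, b))).symm
    refine ⟨(x, y), fun s => ?_⟩
    have hs : D s = D (s.1, 0) + D (0, s.2) := by rw [← map_add]; simp
    rw [hs]
    ext
    · simpa [hSX] using hx s.1
    · simpa [hRY] using hy s.2

end DirectSum

section Packs

variable {A B : Type} [NonUnitalNormedRing A] [NormedSpace ℂ A]
    [NonUnitalNormedRing B] [NormedSpace ℂ B]

/-- All operations of the package are expressed by the actions of `A` on `X` and of `B` on `Y`
through `θ : B → A` and a map `T : Y → X` intertwining the actions of `B`. -/
structure EvenPack.Splits (E : EvenPack A B) (e : A) (θ : B →L[ℂ] A) (T : E.Y →L[ℂ] E.X) :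
    Prop where
  lAX_one : ∀ x, E.lAX e x = x
  rXA_one : ∀ x, E.rXA x e = x
  lBX_eq : ∀ β x, E.lBX β x = E.lAX (θ β) x
  rXB_eq : ∀ x β, E.rXB x β = E.rXA x (θ β)
  lAY_eq : ∀ a y, E.lAY a y = E.lAX a (T y)
  rYA_eq : ∀ y a, E.rYA y a = E.rXA (T y) a
  map_lBY : ∀ β y, T (E.lBY β y) = E.lAX (θ β) (T y)
  map_rYB : ∀ y β, T (E.rYB y β) = E.rXA (T y) (θ β)

/-- All operations of the package are expressed by the actions of `A` on `X` and of `B` on `Y`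
through `θ : B → A` and a map `T : X → Y` intertwining the actions of `B`. -/
structure OddPack.Splits (P : OddPack A B) (e : A) (θ : B →L[ℂ] A) (T : P.X →L[ℂ] P.Y) :
    Prop where
  lAX_one : ∀ x, P.lAX e x = x
  rXA_one : ∀ x, P.rXA x e = x
  lBX_eq : ∀ β x, P.lBX β x = P.lAX (θ β) x
  rXB_eq : ∀ x β, P.rXB x β = P.rXA x (θ β)
  lAXY_eq : ∀ a x, P.lAXY a x = T (P.lAX a x)
  rXAY_eq : ∀ x a, P.rXAY x a = T (P.rXA x a)
  map_lAX : ∀ β x, T (P.lAX (θ β) x) = P.lBY β (T x)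
  map_rXA : ∀ x β, T (P.rXA x (θ β)) = P.rYB (T x) β

variable {e : A} {θ : B →L[ℂ] A}

theorem EvenPack.Splits.dualE {E : EvenPack A B} {T : E.Y →L[ℂ] E.X} (h : E.Splits e θ T) :
    (dualE E).Splits e θ ((compL ℂ E.Y E.X ℂ).flip T) where
  lAX_one (f : E.X →L[ℂ] ℂ) := ContinuousLinearMap.ext fun x =>
    congrArg f (h.rXA_one x)
  rXA_one (f : E.X →L[ℂ] ℂ) := ContinuousLinearMap.ext fun x =>
    congrArg f (h.lAX_one x)
  lBX_eq β (f : E.X →L[ℂ] ℂ) := ContinuousLinearMap.ext fun x =>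
    congrArg f (h.rXB_eq x β)
  rXB_eq (f : E.X →L[ℂ] ℂ) β := ContinuousLinearMap.ext fun x =>
    congrArg f (h.lBX_eq β x)
  lAXY_eq a (f : E.X →L[ℂ] ℂ) := ContinuousLinearMap.ext fun y =>
    congrArg f (h.rYA_eq y a)
  rXAY_eq (f : E.X →L[ℂ] ℂ) a := ContinuousLinearMap.ext fun y =>
    congrArg f (h.lAY_eq a y)
  map_lAX β (f : E.X →L[ℂ] ℂ) := ContinuousLinearMap.ext fun y =>
    (congrArg f (h.map_rYB y β)).symm
  map_rXA (f : E.X →L[ℂ] ℂ) β := ContinuousLinearMap.ext fun y =>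
    (congrArg f (h.map_lBY β y)).symm

theorem OddPack.Splits.dualO {P : OddPack A B} {T : P.X →L[ℂ] P.Y} (h : P.Splits e θ T) :
    (dualO P).Splits e θ ((compL ℂ P.X P.Y ℂ).flip T) where
  lAX_one (f : P.X →L[ℂ] ℂ) := ContinuousLinearMap.ext fun x =>
    congrArg f (h.rXA_one x)
  rXA_one (f : P.X →L[ℂ] ℂ) := ContinuousLinearMap.ext fun x =>
    congrArg f (h.lAX_one x)
  lBX_eq β (f : P.X →L[ℂ] ℂ) := ContinuousLinearMap.ext fun x =>
    congrArg f (h.rXB_eq x β)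
  rXB_eq (f : P.X →L[ℂ] ℂ) β := ContinuousLinearMap.ext fun x =>
    congrArg f (h.lBX_eq β x)
  lAY_eq a (f : P.Y →L[ℂ] ℂ) := ContinuousLinearMap.ext fun x =>
    congrArg f (h.rXAY_eq x a)
  rYA_eq (f : P.Y →L[ℂ] ℂ) a := ContinuousLinearMap.ext fun x =>
    congrArg f (h.lAXY_eq a x)
  map_lBY β (f : P.Y →L[ℂ] ℂ) := ContinuousLinearMap.ext fun x =>
    (congrArg f (h.map_rXA x β)).symm
  map_rYB (f : P.Y →L[ℂ] ℂ) β := ContinuousLinearMap.ext fun x =>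
    (congrArg f (h.map_lAX β x)).symm

namespace BiAction

variable [IsScalarTower ℂ A A] [SMulCommClass ℂ A A]
    [IsScalarTower ℂ B B] [SMulCommClass ℂ B B] (σ : BiAction A B)

theorem l_eq_mul (he₁ : ∀ a : A, e * a = a) (β : B) (a : A) : σ.l β a = σ.l β e * a := by
  rw [← σ.compat_l, he₁]

theorem r_eq_mul (he₂ : ∀ a : A, a * e = a) (a : A) (β : B) : σ.r a β = a * σ.l β e := by
  rw [σ.compat_m, he₂]

theorem l_mul_unit (he₁ : ∀ a : A, e * a = a) (β γ : B) :
    σ.l (β * γ) e = σ.l β e * σ.l γ e := by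
  rw [σ.l_mul, σ.l_eq_mul he₁]

theorem basePack_splits (he₁ : ∀ a : A, e * a = a) (he₂ : ∀ a : A, a * e = a) :
    (basePack σ).Splits e (σ.l.flip e) (σ.l.flip e) where
  lAX_one := he₁
  rXA_one := he₂
  lBX_eq := σ.l_eq_mul he₁
  rXB_eq := σ.r_eq_mul he₂
  lAY_eq := σ.r_eq_mul he₂
  rYA_eq := σ.l_eq_mul he₁
  map_lBY := σ.l_mul_unit he₁
  map_rYB := σ.l_mul_unit he₁

theorem evenPackAt_splits (he₁ : ∀ a : A, e * a = a) (he₂ : ∀ a : A, a * e = a) (m : ℕ) :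
    ∃ T, (evenPackAt σ m).Splits e (σ.l.flip e) T := by
  induction m with
  | zero => exact ⟨_, σ.basePack_splits he₁ he₂⟩
  | succ m ih =>
    obtain ⟨T, hT⟩ := ih
    exact ⟨_, hT.dualE.dualO⟩

end BiAction

end Packs

/-- The shear `(x, y) ↦ (x + T y, y)`. -/
def prodShear {X Y : Type} [NormedAddCommGroup X] [NormedSpace ℂ X]
    [NormedAddCommGroup Y] [NormedSpace ℂ Y] (T : Y →L[ℂ] X) : (X × Y) ≃L[ℂ] (X × Y) :=
  .equivOfInverse ((fst ℂ X Y + T.comp (snd ℂ X Y)).prod (snd ℂ X Y))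
    ((fst ℂ X Y - T.comp (snd ℂ X Y)).prod (snd ℂ X Y))
    (fun z => by simp) (fun z => by simp)

@[simp] theorem prodShear_apply {X Y : Type} [NormedAddCommGroup X] [NormedSpace ℂ X]
    [NormedAddCommGroup Y] [NormedSpace ℂ Y] (T : Y →L[ℂ] X) (z : X × Y) :
    prodShear T z = (z.1 + T z.2, z.2) := rfl

/-- The shear `(x, y) ↦ (x, y - T x)`. -/
def prodCoshear {X Y : Type} [NormedAddCommGroup X] [NormedSpace ℂ X]
    [NormedAddCommGroup Y] [NormedSpace ℂ Y] (T : X →L[ℂ] Y) : (X × Y) ≃L[ℂ] (X × Y) :=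
  .equivOfInverse ((fst ℂ X Y).prod (snd ℂ X Y - T.comp (fst ℂ X Y)))
    ((fst ℂ X Y).prod (snd ℂ X Y + T.comp (fst ℂ X Y)))
    (fun z => by simp) (fun z => by simp)

@[simp] theorem prodCoshear_apply {X Y : Type} [NormedAddCommGroup X] [NormedSpace ℂ X]
    [NormedAddCommGroup Y] [NormedSpace ℂ Y] (T : X →L[ℂ] Y) (z : X × Y) :
    prodCoshear T z = (z.1, z.2 - T z.1) := rfl

section Main

variable {A B : Type} [NonUnitalNormedRing A] [NormedSpace ℂ A]
    [IsScalarTower ℂ A A] [SMulCommClass ℂ A A]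
    [NonUnitalNormedRing B] [NormedSpace ℂ B] [IsScalarTower ℂ B B] [SMulCommClass ℂ B B]
    {e : A} (σ : BiAction A B)

/-- The shear by `β ↦ β · e` is multiplicative from `A ⋊ B` to the direct sum `A × B`. -/
theorem prodShear_dupMul (he₁ : ∀ a : A, e * a = a) (he₂ : ∀ a : A, a * e = a) (s t : A × B) :
    prodShear (σ.l.flip e) (dupMul σ s t) =
      prodShear (σ.l.flip e) s * prodShear (σ.l.flip e) t := by
  ext
  · simp only [dupMul, prodShear_apply, flip_apply, Prod.fst_mul, add_mul, mul_add]
    rw [σ.l_mul_unit he₁, σ.r_eq_mul he₂, σ.l_eq_mul he₁ s.2 t.1]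
    abel
  · rfl

theorem dupWAEven_iff_of_splits (he₁ : ∀ a : A, e * a = a) (he₂ : ∀ a : A, a * e = a)
    {E : EvenPack A B} {T : E.Y →L[ℂ] E.X} (h : E.Splits e (σ.l.flip e) T) :
    DupWAEven σ E ↔ AWAEven E ∧ BWAEven E := by
  refine (derivationsInner_congr (prodShear (σ.l.flip e)) (prodShear T)
    (prodShear_dupMul σ he₁ he₂) (fun s z => ?_) fun z s => ?_).trans
    (derivationsInner_prod_iff E.lAX E.rXA E.lBY E.rYB e he₂ h.lAX_one)
  · ext
    · simp only [leftActE, prodShear_apply, h.lBX_eq, h.lAY_eq, h.map_lBY, map_add, add_apply]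
      abel
    · rfl
  · ext
    · simp only [rightActE, prodShear_apply, h.rXB_eq, h.rYA_eq, h.map_rYB, map_add, add_apply]
      abel
    · rfl

theorem dupWAOdd_iff_of_splits (he₁ : ∀ a : A, e * a = a) (he₂ : ∀ a : A, a * e = a)
    {P : OddPack A B} {T : P.X →L[ℂ] P.Y} (h : P.Splits e (σ.l.flip e) T) :
    DupWAOdd σ P ↔ AWAOdd P ∧ BWAOdd P := by
  refine (derivationsInner_congr (prodShear (σ.l.flip e)) (prodCoshear T)
    (prodShear_dupMul σ he₁ he₂) (fun s z => ?_) fun z s => ?_).trans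
    (derivationsInner_prod_iff P.lAX P.rXA P.lBY P.rYB e he₂ h.lAX_one)
  · ext
    · simp only [leftActO, prodShear_apply, prodCoshear_apply, h.lBX_eq, map_add, add_apply]
    · simp only [leftActO, prodShear_apply, prodCoshear_apply, h.lBX_eq, h.lAXY_eq, h.map_lAX,
        map_add, map_sub]
      abel
  · ext
    · simp only [rightActO, prodShear_apply, prodCoshear_apply, h.rXB_eq, map_add]
    · simp only [rightActO, prodShear_apply, prodCoshear_apply, h.rXB_eq, h.rXAY_eq, h.map_rXA,
        map_add, map_sub, sub_apply]
      abel

end Main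

/-- Let `𝒜` be unital, with identity `e`.  Then for every
`n ∈ ℕ ∪ {0}` (covered below as `n = 2m` and `n = 2m + 1`), the amalgamated duplication
`𝒜 ⋊ 𝔄` is `n`-weakly amenable if and only if both `𝒜` and `𝔄` are `n`-weakly amenable. -/
theorem dup_n_weakly_amenable_iff_of_unital
    (e : A) (he₁ : ∀ a : A, e * a = a) (he₂ : ∀ a : A, a * e = a) :
    (∀ (m : ℕ) (E : EvenPack A B), E = evenPackAt σ m →
      (DupWAEven σ E ↔ (AWAEven E ∧ BWAEven E))) ∧
    (∀ (m : ℕ) (P : OddPack A B), P = oddPackAt σ m →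
      (DupWAOdd σ P ↔ (AWAOdd P ∧ BWAOdd P))) := by
  constructor
  · rintro m _ rfl
    obtain ⟨T, hT⟩ := σ.evenPackAt_splits he₁ he₂ m
    exact dupWAEven_iff_of_splits σ he₁ he₂ hT
  · rintro m _ rfl
    obtain ⟨T, hT⟩ := σ.evenPackAt_splits he₁ he₂ m
    exact dupWAOdd_iff_of_splits σ he₁ he₂ hT.dualE

end
end
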